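/- There exist constants C > 0 and λ₀ > 0 such that for all real λ ≥ λ₀, the variance of L satisfies |Var[L] − λ²/12 − λ·(log λ)/2| ≤ C·λ, where Var[L] = Ex[L²] − (Ex[L])². -/

import Mathlib

/-- `D lam l = ∑_{k=0}^{l} l! / ((l-k)! * lam^k)`. -/
noncomputable def D (lam : ℝ) (l : ℕ) : ℝ :=
  ∑ k ∈ Finset.range (l + 1),
    (Nat.factorial l : ℝ) / ((Nat.factorial (l - k) : ℝ) * lam ^ k)

/-- The overflow load `lam / D lam l` offered to the servers of index greater than `l`. -/
noncomputable def overflow (lam : ℝ) (l : ℕ) : ℝ := lam / D lam l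

/-- The excess of the overflow load over its fluid approximation `lam - l`. -/
noncomputable def excess (lam : ℝ) (l : ℕ) : ℝ := overflow lam l - (lam - l)

/-- The index `⌊lam - √lam⌋` at which the moment series are split. -/
noncomputable def splitIndex (lam : ℝ) : ℕ := ⌊lam - √lam⌋₊

section Recursion

variable {lam : ℝ}

theorem D_zero (lam : ℝ) : D lam 0 = 1 := by simp [D]

theorem D_succ (hlam : 0 < lam) (l : ℕ) : D lam (l + 1) = 1 + (l + 1) / lam * D lam l := by
  unfold D
  rw [Finset.sum_range_succ', Finset.mul_sum, add_comm]
  congr 1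
  · have : (Nat.factorial (l + 1) : ℝ) ≠ 0 := by positivity
    simp [this]
  · refine Finset.sum_congr rfl fun k _ => ?_
    rw [Nat.add_sub_add_right, Nat.factorial_succ]
    push_cast
    have : (Nat.factorial (l - k) : ℝ) ≠ 0 := by positivity
    field_simp
    ring

theorem D_pos (hlam : 0 < lam) (l : ℕ) : 0 < D lam l := by
  induction l with
  | zero => simp [D_zero]
  | succ l ih => rw [D_succ hlam]; positivity

theorem overflow_pos (hlam : 0 < lam) (l : ℕ) : 0 < overflow lam l :=
  div_pos hlam (D_pos hlam l)

theorem overflow_succ_mul (hlam : 0 < lam) (l : ℕ) :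
    overflow lam (l + 1) * (l + 1 + overflow lam l) = lam * overflow lam l := by
  have h1 := (D_pos hlam l).ne'
  have h2 := (D_pos hlam (l + 1)).ne'
  have h3 := D_succ hlam l
  unfold overflow
  field_simp at h3 ⊢
  linarith

theorem succ_mul_overflow_succ_le (hlam : 0 < lam) (l : ℕ) :
    (l + 1) * overflow lam (l + 1) ≤ lam * overflow lam l := by
  nlinarith [overflow_succ_mul hlam l, overflow_pos hlam l, overflow_pos hlam (l + 1)]

theorem excess_zero (lam : ℝ) : excess lam 0 = 0 := by simp [excess, overflow, D_zero]

theorem excess_succ_mul (hlam : 0 < lam) (l : ℕ) :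
    excess lam (l + 1) * (lam + 1 + excess lam l) = (l + 1) * (1 + excess lam l) := by
  have h := overflow_succ_mul hlam l
  unfold excess
  push_cast
  linear_combination h

theorem excess_nonneg (hlam : 0 < lam) (l : ℕ) : 0 ≤ excess lam l := by
  induction l with
  | zero => simp [excess_zero]
  | succ l ih =>
    have h := excess_succ_mul hlam l
    have hp : 0 < lam + 1 + excess lam l := by positivity
    exact nonneg_of_mul_nonneg_left (h ▸ by positivity) hp

theorem excess_succ_mul_le_of_excess_mul_le (hlam : 0 < lam) {l : ℕ}
    (h : excess lam l * (lam - l) ≤ l) : excess lam (l + 1) * (lam - l) ≤ l + 1 := by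
  have hu := excess_nonneg hlam l
  have hp : 0 < lam + 1 + excess lam l := by positivity
  refine le_of_mul_le_mul_right ?_ hp
  calc excess lam (l + 1) * (lam - l) * (lam + 1 + excess lam l)
      = (l + 1) * ((1 + excess lam l) * (lam - l)) := by
        linear_combination (lam - l) * excess_succ_mul hlam l
    _ ≤ (l + 1) * (lam + 1 + excess lam l) := by gcongr; linarith

theorem excess_mul_le (hlam : 0 < lam) (l : ℕ) : excess lam l * (lam - l) ≤ l := by
  induction l with
  | zero => simp [excess_zero]
  | succ l ih =>
    have h := excess_succ_mul_le_of_excess_mul_le hlam ih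
    have hu := excess_nonneg hlam (l + 1)
    push_cast
    linarith

theorem overflow_antitone (hlam : 0 < lam) : Antitone (overflow lam) := by
  refine antitone_nat_of_succ_le fun l => ?_
  have h := overflow_succ_mul hlam l
  have hu : excess lam l = overflow lam l - (lam - l) := rfl
  have hn := excess_nonneg hlam l
  have hp := overflow_pos hlam (l + 1)
  by_contra! hc
  have : lam < l + 1 + overflow lam l := by linarith
  nlinarith

end Recursion

section Split

variable {lam : ℝ}

theorem sqrt_le_sub_splitIndex (hlam : 1 ≤ lam) : √lam ≤ lam - splitIndex lam := by
  have h : √lam ≤ lam := Real.sqrt_le_self_iff.2 (Or.inr hlam)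
  have := Nat.floor_le (sub_nonneg.2 h)
  unfold splitIndex
  linarith

theorem sub_splitIndex_lt (lam : ℝ) : lam - splitIndex lam < √lam + 1 := by
  have := Nat.lt_floor_add_one (lam - √lam)
  unfold splitIndex
  linarith

theorem excess_splitIndex_le (hlam : 1 ≤ lam) : excess lam (splitIndex lam) ≤ √lam := by
  have h1 := sqrt_le_sub_splitIndex hlam
  have h2 := excess_mul_le (zero_lt_one.trans_le hlam) (splitIndex lam)
  have h3 := excess_nonneg (zero_lt_one.trans_le hlam) (splitIndex lam)
  have hs : 1 ≤ √lam := Real.one_le_sqrt.2 hlam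
  have hq : √lam * √lam = lam := Real.mul_self_sqrt (by linarith)
  by_contra! hc
  nlinarith

theorem overflow_splitIndex_le (hlam : 1 ≤ lam) : overflow lam (splitIndex lam) ≤ 3 * √lam := by
  have h1 := sub_splitIndex_lt lam
  have h2 := excess_splitIndex_le hlam
  have hs : 1 ≤ √lam := Real.one_le_sqrt.2 hlam
  unfold excess at h2
  linarith

end Split

section Excess

variable {lam : ℝ}

theorem sum_inv_sub_le_log {n : ℕ} (hn : (n : ℝ) < lam) :
    ∑ l ∈ Finset.range n, 1 / (lam - l) ≤ Real.log lam - Real.log (lam - n) := by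
  induction n with
  | zero => simp
  | succ n ih =>
    push_cast at hn ⊢
    rw [Finset.sum_range_succ]
    have h1 : 0 < lam - n := by linarith
    have h2 : 0 < lam - (n + 1) := by linarith
    have h := Real.one_sub_inv_le_log_of_pos (div_pos h1 h2)
    rw [Real.log_div h1.ne' h2.ne', inv_div] at h
    have h3 : 1 - (lam - (n + 1)) / (lam - n) = 1 / (lam - n) := by field_simp; ring
    have := ih (by linarith)
    linarith

theorem log_le_sum_inv_sub {n : ℕ} (hn : (n : ℝ) < lam) :
    Real.log (lam + 1) - Real.log (lam - n + 1) ≤ ∑ l ∈ Finset.range n, 1 / (lam - l) := by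
  induction n with
  | zero => simp
  | succ n ih =>
    push_cast at hn ⊢
    rw [Finset.sum_range_succ]
    have h1 : 0 < lam - n := by linarith
    have h2 : 0 < lam - n + 1 := by linarith
    have h := Real.log_le_sub_one_of_pos (div_pos h2 h1)
    rw [Real.log_div h2.ne' h1.ne'] at h
    have h3 : (lam - n + 1) / (lam - n) - 1 = 1 / (lam - n) := by field_simp; ring
    have := ih (by linarith)
    have h4 : lam - (n + 1) + 1 = lam - n := by ring
    rw [h4]
    linarith

theorem sum_inv_sub_cube_le {n : ℕ} (hn : (n : ℝ) < lam) :
    ∑ l ∈ Finset.range n, 1 / (lam - l) ^ 3 ≤ 1 / (lam - n) ^ 2 := by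
  induction n with
  | zero => simp; positivity
  | succ n ih =>
    push_cast at hn ⊢
    rw [Finset.sum_range_succ]
    have := ih (by linarith)
    obtain ⟨j, hj⟩ : ∃ j, j = lam - (n + 1) := ⟨_, rfl⟩
    have h1 : lam - n = j + 1 := by rw [hj]; ring
    have hj0 : 0 < j := by linarith
    rw [← hj]
    rw [h1] at this ⊢
    have : 1 / (j + 1) ^ 2 + 1 / (j + 1) ^ 3 ≤ 1 / j ^ 2 := by
      rw [div_add_div _ _ (by positivity) (by positivity),
        div_le_div_iff₀ (by positivity) (by positivity)]
      have : 0 ≤ (j + 1) ^ 2 * (j ^ 2 + 2 * j + 1) := by positivity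
      nlinarith [pow_pos hj0 2, pow_pos hj0 3, pow_pos hj0 4]
    linarith

theorem sum_excess_le (hlam : 1 ≤ lam) :
    ∑ l ∈ Finset.range (splitIndex lam), excess lam l ≤ lam * Real.log lam / 2 := by
  have h0 : 0 < lam := by linarith
  have hs : 0 < √lam := Real.sqrt_pos.2 h0
  have hK := sqrt_le_sub_splitIndex hlam
  calc ∑ l ∈ Finset.range (splitIndex lam), excess lam l
      ≤ ∑ l ∈ Finset.range (splitIndex lam), lam * (1 / (lam - l)) := by
        refine Finset.sum_le_sum fun l hl => ?_
        have hl' : (l : ℝ) < splitIndex lam := by exact_mod_cast Finset.mem_range.1 hl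
        rw [mul_one_div, le_div_iff₀ (by linarith)]
        linarith [excess_mul_le h0 l]
    _ = lam * ∑ l ∈ Finset.range (splitIndex lam), 1 / (lam - l) := by rw [Finset.mul_sum]
    _ ≤ lam * (Real.log lam - Real.log (lam - splitIndex lam)) := by
        gcongr
        exact sum_inv_sub_le_log (by linarith)
    _ ≤ lam * (Real.log lam - Real.log (√lam)) := by gcongr
    _ = lam * Real.log lam / 2 := by rw [Real.log_sqrt h0.le]; ring

theorem div_sub_le_excess_succ_add (hlam : 0 < lam) {l : ℕ} (hl : (l : ℝ) < lam) :
    (l + 1) / (lam - l) - lam ^ 2 * (1 / (lam - l) ^ 3) ≤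
      excess lam (l + 1) + ((l + 1) * excess lam (l + 1) / (lam - l)
        - l * excess lam l / (lam - l + 1)) := by
  have hj : 0 < lam - l := by linarith
  have hu := excess_nonneg hlam l
  have hv := excess_nonneg hlam (l + 1)
  have hu1 : excess lam l ≤ lam / (lam - l) := by
    rw [le_div_iff₀ hj]; linarith [excess_mul_le hlam l]
  have hrec := excess_succ_mul hlam l
  have hprod : excess lam l * excess lam (l + 1) ≤ lam ^ 2 / (lam - l) ^ 2 := by
    have hv3 : excess lam (l + 1) ≤ lam / (lam - l) := by
      have hp : 0 < lam + 1 + excess lam l := by positivity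
      rw [le_div_iff₀ hj]
      refine le_of_mul_le_mul_right ?_ hp
      nlinarith [excess_mul_le hlam l]
    calc excess lam l * excess lam (l + 1) ≤ lam / (lam - l) * (lam / (lam - l)) := by gcongr
      _ = lam ^ 2 / (lam - l) ^ 2 := by rw [div_mul_div_comm, sq, sq]
  have hF : (l : ℝ) * excess lam l / (lam - l + 1) ≤ (l + 1) * excess lam l / (lam - l) := by
    gcongr <;> linarith
  have hkey : (l + 1) / (lam - l) = excess lam (l + 1) + ((l + 1) * excess lam (l + 1) / (lam - l)
      - (l + 1) * excess lam l / (lam - l)) + excess lam l * excess lam (l + 1) / (lam - l) := by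
    field_simp
    linear_combination -hrec
  have hlast : excess lam l * excess lam (l + 1) / (lam - l) ≤ lam ^ 2 * (1 / (lam - l) ^ 3) := by
    calc excess lam l * excess lam (l + 1) / (lam - l)
        ≤ lam ^ 2 / (lam - l) ^ 2 / (lam - l) := by gcongr
      _ = lam ^ 2 * (1 / (lam - l) ^ 3) := by field_simp
  linarith

theorem sum_div_sub_le (hlam : 0 < lam) {n : ℕ} (hn : (n : ℝ) < lam) :
    (lam + 1) * ∑ l ∈ Finset.range n, 1 / (lam - l) - n
        - lam ^ 2 * ∑ l ∈ Finset.range n, 1 / (lam - l) ^ 3 ≤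
      ∑ l ∈ Finset.range n, excess lam l + excess lam n
        + n * excess lam n / (lam - n + 1) := by
  induction n with
  | zero => simp [excess_zero]
  | succ n ih =>
    push_cast at hn ⊢
    have hn' : (n : ℝ) < lam := by linarith
    have h := div_sub_le_excess_succ_add hlam hn'
    have h1 : ((n : ℝ) + 1) / (lam - n) = (lam + 1) * (1 / (lam - n)) - 1 := by
      have : lam - n ≠ 0 := by linarith
      field_simp
      ring
    have h4 : lam - (n + 1) + 1 = lam - n := by ring
    rw [Finset.sum_range_succ, Finset.sum_range_succ, Finset.sum_range_succ, h4]
    have := ih hn'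
    linarith

theorem le_sum_excess (hlam : 1 ≤ lam) :
    lam * Real.log lam / 2 - 6 * lam ≤ ∑ l ∈ Finset.range (splitIndex lam), excess lam l := by
  have h0 : 0 < lam := by linarith
  have hs : 1 ≤ √lam := Real.one_le_sqrt.2 hlam
  have hq : √lam * √lam = lam := Real.mul_self_sqrt h0.le
  have hK := sqrt_le_sub_splitIndex hlam
  have hK' := sub_splitIndex_lt lam
  have hKl : (splitIndex lam : ℝ) < lam := by linarith
  have hu := excess_splitIndex_le hlam
  have hu0 := excess_nonneg h0 (splitIndex lam)
  have hsum := sum_div_sub_le h0 hKl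
  have hcube := sum_inv_sub_cube_le hKl
  have hlog := log_le_sum_inv_sub hKl
  have hcube' : lam ^ 2 * ∑ l ∈ Finset.range (splitIndex lam), 1 / (lam - l) ^ 3 ≤ lam := by
    calc lam ^ 2 * ∑ l ∈ Finset.range (splitIndex lam), 1 / (lam - l) ^ 3
        ≤ lam ^ 2 * (1 / (√lam) ^ 2) := by
          gcongr
          exact hcube.trans (by gcongr)
      _ = lam := by rw [Real.sq_sqrt h0.le]; field_simp
  have hF : splitIndex lam * excess lam (splitIndex lam) / (lam - splitIndex lam + 1) ≤ lam := by
    rw [div_le_iff₀ (by linarith)]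
    have : (splitIndex lam : ℝ) * excess lam (splitIndex lam) ≤ lam * √lam := by gcongr
    nlinarith
  have hlog' : Real.log lam / 2 - 2 ≤ ∑ l ∈ Finset.range (splitIndex lam), 1 / (lam - l) := by
    have h1 : Real.log lam ≤ Real.log (lam + 1) := Real.log_le_log h0 (by linarith)
    have h2 : Real.log (lam - splitIndex lam + 1) ≤ Real.log (3 * √lam) :=
      Real.log_le_log (by linarith) (by linarith)
    have h3 : Real.log 3 ≤ 3 - 1 := Real.log_le_sub_one_of_pos (by norm_num)
    rw [Real.log_mul (by norm_num) (by positivity), Real.log_sqrt h0.le] at h2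
    linarith
  have hS : 0 ≤ ∑ l ∈ Finset.range (splitIndex lam), 1 / (lam - l) := by
    refine Finset.sum_nonneg fun l hl => ?_
    have hl' : (l : ℝ) < splitIndex lam := by exact_mod_cast Finset.mem_range.1 hl
    exact one_div_nonneg.2 (by linarith)
  have hmul := mul_le_mul_of_nonneg_left hlog' h0.le
  nlinarith

end Excess

section Tail

variable {lam : ℝ}

theorem sqrt_mul_overflow_succ_le (hlam : 1 ≤ lam) {l : ℕ} (hl : splitIndex lam ≤ l) :
    √lam * overflow lam (l + 1) + lam * overflow lam (l + 1)
        + 3 * √lam * (max 0 (lam + √lam - (l + 1))) ^ 2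
      ≤ lam * overflow lam l + 3 * √lam * (max 0 (lam + √lam - l)) ^ 2 := by
  have h0 : 0 < lam := by linarith
  have hs : 1 ≤ √lam := Real.one_le_sqrt.2 hlam
  have hrec := succ_mul_overflow_succ_le h0 l
  have hp := overflow_pos h0 (l + 1)
  have hle : overflow lam (l + 1) ≤ 3 * √lam :=
    (overflow_antitone h0 (hl.trans l.le_succ)).trans (overflow_splitIndex_le hlam)
  rcases le_total (lam + √lam - (l + 1)) 0 with h | h
  · rw [max_eq_left h]
    have : 0 ≤ 3 * √lam * (max 0 (lam + √lam - l)) ^ 2 := by positivity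
    nlinarith
  · rw [max_eq_right h, max_eq_right (by linarith)]
    have h1 : (lam + √lam - (l + 1)) * overflow lam (l + 1)
        ≤ (lam + √lam - (l + 1)) * (3 * √lam) := by gcongr
    nlinarith [mul_nonneg h (zero_le_one.trans hs)]

theorem sum_overflow_tail_le (hlam : 1 ≤ lam) (n : ℕ) :
    ∑ i ∈ Finset.range n, overflow lam (i + splitIndex lam) ≤ 33 * lam := by
  have h0 : 0 < lam := by linarith
  have hs : 1 ≤ √lam := Real.one_le_sqrt.2 hlam
  have hq : √lam * √lam = lam := Real.mul_self_sqrt h0.le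
  set K := splitIndex lam with hKdef
  have hpot : √lam * ∑ i ∈ Finset.range n, overflow lam (i + K)
      + √lam * overflow lam (n + K) + lam * overflow lam (n + K)
        + 3 * √lam * (max 0 (lam + √lam - (n + K : ℕ))) ^ 2
      ≤ √lam * overflow lam K + lam * overflow lam K
        + 3 * √lam * (max 0 (lam + √lam - K)) ^ 2 := by
    induction n with
    | zero => simp
    | succ n ih =>
      have h := sqrt_mul_overflow_succ_le hlam (Nat.le_add_left K n)
      rw [Finset.sum_range_succ, show n + 1 + K = n + K + 1 by ring]
      push_cast at h ih ⊢
      linarith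
  have hK := sub_splitIndex_lt lam
  have ha := overflow_splitIndex_le hlam
  rw [← hKdef] at hK ha
  have hp := overflow_pos h0 (n + K)
  have hmax : (max 0 (lam + √lam - K)) ^ 2 ≤ (3 * √lam) ^ 2 := by
    gcongr
    exact max_le (by linarith) (by linarith)
  have h1 : 0 ≤ √lam * overflow lam (n + K) + lam * overflow lam (n + K)
      + 3 * √lam * (max 0 (lam + √lam - (n + K : ℕ))) ^ 2 := by positivity
  have h2 : 3 * √lam * (max 0 (lam + √lam - K)) ^ 2 ≤ 3 * √lam * (3 * √lam) ^ 2 := by gcongr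
  have h3 : (√lam + lam) * overflow lam K ≤ (√lam + lam) * (3 * √lam) := by gcongr
  have h4 : 3 * √lam * (3 * √lam) ^ 2 = √lam * (27 * lam) := by
    linear_combination 27 * √lam * hq
  have h5 : (√lam + lam) * (3 * √lam) ≤ √lam * (6 * lam) := by nlinarith
  refine le_of_mul_le_mul_left ?_ (zero_lt_one.trans_le hs)
  linarith

theorem sum_mul_overflow_tail_le (hlam : 1 ≤ lam) (n : ℕ) :
    ∑ i ∈ Finset.range n, (2 * ((i + splitIndex lam : ℕ) : ℝ) + 1)
        * overflow lam (i + splitIndex lam)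
      ≤ 105 * lam ^ 2 := by
  have h0 : 0 < lam := by linarith
  have hs : 1 ≤ √lam := Real.one_le_sqrt.2 hlam
  have hq : √lam * √lam = lam := Real.mul_self_sqrt h0.le
  have hK := sqrt_le_sub_splitIndex hlam
  have ha := overflow_splitIndex_le hlam
  have hT := sum_overflow_tail_le hlam n
  set K := splitIndex lam
  have hpot : ∑ i ∈ Finset.range n, (2 * ((i + K : ℕ) : ℝ) + 1) * overflow lam (i + K)
      + 2 * ((n + K : ℕ) : ℝ) * overflow lam (n + K)
      ≤ 2 * K * overflow lam K + (2 * lam + 1) * ∑ i ∈ Finset.range n, overflow lam (i + K) := by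
    clear hT
    induction n with
    | zero => simp
    | succ n ih =>
      have h := succ_mul_overflow_succ_le h0 (n + K)
      rw [Finset.sum_range_succ, Finset.sum_range_succ, show n + 1 + K = n + K + 1 by ring]
      push_cast at h ih ⊢
      linarith
  have hp := overflow_pos h0 (n + K)
  have h1 : 0 ≤ 2 * ((n + K : ℕ) : ℝ) * overflow lam (n + K) := by positivity
  have h2 : 2 * K * overflow lam K ≤ 2 * lam * (3 * √lam) := by
    have := overflow_pos h0 K
    gcongr
    linarith
  have h3 : (2 * lam + 1) * ∑ i ∈ Finset.range n, overflow lam (i + K)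
      ≤ (2 * lam + 1) * (33 * lam) := by gcongr
  nlinarith

end Tail

section Moments

variable {lam : ℝ}

theorem sum_range_sub (lam : ℝ) (n : ℕ) :
    ∑ l ∈ Finset.range n, (lam - l) = n * lam - n * (n - 1) / 2 := by
  induction n with
  | zero => simp
  | succ n ih => rw [Finset.sum_range_succ, ih]; push_cast; ring

theorem sum_range_mul_sub (lam : ℝ) (n : ℕ) :
    ∑ l ∈ Finset.range n, (2 * (l : ℝ) + 1) * (lam - l)
      = lam * n ^ 2 - 2 * n ^ 3 / 3 + n ^ 2 / 2 + n / 6 := by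
  induction n with
  | zero => simp
  | succ n ih => rw [Finset.sum_range_succ, ih]; push_cast; ring

theorem exists_tsum_eq_sum_range_add {f : ℕ → ℝ} (hf : ∀ n, 0 ≤ f n) (K : ℕ) {c : ℝ}
    (h : ∀ n, ∑ i ∈ Finset.range n, f (i + K) ≤ c) :
    ∃ t, 0 ≤ t ∧ t ≤ c ∧ ∑' n, f n = ∑ n ∈ Finset.range K, f n + t := by
  have hs : Summable fun i => f (i + K) := summable_of_sum_range_le (fun i => hf _) h
  exact ⟨∑' i, f (i + K), tsum_nonneg fun i => hf _,
    Real.tsum_le_of_sum_range_le (fun i => hf _) h,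
    (((summable_nat_add_iff K).1 hs).sum_add_tsum_nat_add K).symm⟩

theorem abs_mul_first_moment_sub_le (hlam : 1 ≤ lam) :
    |∑' l, overflow lam l - lam ^ 2 / 2 - lam * Real.log lam / 2| ≤ 50 * lam := by
  have h0 : 0 < lam := by linarith
  have hs : 1 ≤ √lam := Real.one_le_sqrt.2 hlam
  have hq : √lam * √lam = lam := Real.mul_self_sqrt h0.le
  obtain ⟨t, ht0, ht, hsum⟩ := exists_tsum_eq_sum_range_add
    (fun n => (overflow_pos h0 n).le) (splitIndex lam) (sum_overflow_tail_le hlam)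
  have hU := sum_excess_le hlam
  have hL := le_sum_excess hlam
  have hK := sqrt_le_sub_splitIndex hlam
  have hK' := sub_splitIndex_lt lam
  have hsplit : ∑ n ∈ Finset.range (splitIndex lam), overflow lam n
      = ∑ n ∈ Finset.range (splitIndex lam), (lam - n)
        + ∑ n ∈ Finset.range (splitIndex lam), excess lam n := by
    rw [← Finset.sum_add_distrib]
    exact Finset.sum_congr rfl fun l _ => by simp [excess]
  rw [hsum, hsplit, sum_range_sub]
  obtain ⟨d, hd⟩ : ∃ d, d = lam - splitIndex lam := ⟨_, rfl⟩
  have hKd : (splitIndex lam : ℝ) = lam - d := by linarith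
  have hK0 : (0 : ℝ) ≤ splitIndex lam := by positivity
  rw [← hd] at hK hK'
  rw [hKd] at hK0 ⊢
  have hd2 : d ^ 2 ≤ 4 * lam := by nlinarith
  have hd3 : 0 ≤ d ^ 2 := sq_nonneg d
  have hmain : (lam - d) * lam - (lam - d) * (lam - d - 1) / 2
      = lam ^ 2 / 2 - d ^ 2 / 2 + (lam - d) / 2 := by ring
  rw [hmain, abs_le]
  constructor <;> linarith

theorem abs_mul_second_moment_sub_le (hlam : 1 ≤ lam) :
    |∑' l : ℕ, (2 * (l : ℝ) + 1) * overflow lam l - lam ^ 3 / 3 - lam ^ 2 * Real.log lam|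
      ≤ 200 * lam ^ 2 := by
  have h0 : 0 < lam := by linarith
  have hs : 1 ≤ √lam := Real.one_le_sqrt.2 hlam
  have hq : √lam * √lam = lam := Real.mul_self_sqrt h0.le
  obtain ⟨t, ht0, ht, hsum⟩ := exists_tsum_eq_sum_range_add
    (f := fun l : ℕ => (2 * (l : ℝ) + 1) * overflow lam l)
    (fun n => mul_nonneg (by positivity) (overflow_pos h0 n).le) (splitIndex lam)
    (sum_mul_overflow_tail_le hlam)
  have hU := sum_excess_le hlam
  have hL := le_sum_excess hlam
  have hK := sqrt_le_sub_splitIndex hlam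
  have hK' := sub_splitIndex_lt lam
  have hsplit : ∑ n ∈ Finset.range (splitIndex lam), (2 * (n : ℝ) + 1) * overflow lam n
      = ∑ n ∈ Finset.range (splitIndex lam), (2 * (n : ℝ) + 1) * (lam - n)
        + ∑ n ∈ Finset.range (splitIndex lam), (2 * (n : ℝ) + 1) * excess lam n := by
    rw [← Finset.sum_add_distrib]
    exact Finset.sum_congr rfl fun l _ => by simp only [excess]; ring
  have hVU : ∑ n ∈ Finset.range (splitIndex lam), (2 * (n : ℝ) + 1) * excess lam n
      ≤ (2 * lam + 1) * ∑ n ∈ Finset.range (splitIndex lam), excess lam n := by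
    rw [Finset.mul_sum]
    refine Finset.sum_le_sum fun l hl => ?_
    have hl' : (l : ℝ) < splitIndex lam := by exact_mod_cast Finset.mem_range.1 hl
    have := excess_nonneg h0 l
    gcongr
    linarith
  have hVL : 2 * lam * ∑ n ∈ Finset.range (splitIndex lam), excess lam n
        - splitIndex lam * (2 * lam)
      ≤ ∑ n ∈ Finset.range (splitIndex lam), (2 * (n : ℝ) + 1) * excess lam n := by
    have hc : (splitIndex lam : ℝ) * (2 * lam)
        = ∑ n ∈ Finset.range (splitIndex lam), 2 * lam := by simp
    rw [Finset.mul_sum, hc, ← Finset.sum_sub_distrib]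
    refine Finset.sum_le_sum fun l hl => ?_
    have hl' : (l : ℝ) < splitIndex lam := by exact_mod_cast Finset.mem_range.1 hl
    have := excess_nonneg h0 l
    linarith [excess_mul_le h0 l]
  rw [hsum, hsplit, sum_range_mul_sub]
  set U := ∑ n ∈ Finset.range (splitIndex lam), excess lam n
  obtain ⟨d, hd⟩ : ∃ d, d = lam - splitIndex lam := ⟨_, rfl⟩
  have hKd : (splitIndex lam : ℝ) = lam - d := by linarith
  have hK0 : (0 : ℝ) ≤ splitIndex lam := by positivity
  rw [← hd] at hK hK'
  rw [hKd] at hK0 hVL ⊢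
  have hd0 : 0 ≤ d := by linarith
  have hd2 : d ^ 2 ≤ 4 * lam := by nlinarith
  have hd3 : lam * d ^ 2 ≤ lam * (4 * lam) := by gcongr
  have hd4 : d ^ 3 ≤ 4 * lam ^ 2 := by
    calc d ^ 3 = d * d ^ 2 := by ring
      _ ≤ lam * (4 * lam) := by gcongr; linarith
      _ = 4 * lam ^ 2 := by ring
  have hd5 : 0 ≤ d ^ 3 := by positivity
  have hd6 : 0 ≤ lam * d ^ 2 := by positivity
  have hlog : Real.log lam ≤ lam := (Real.log_le_sub_one_of_pos h0).trans (by linarith)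
  have hlog' : lam * Real.log lam ≤ lam * lam := by gcongr
  have hUm : lam * U ≤ lam * (lam * Real.log lam / 2) := by gcongr
  have hLm : lam * (lam * Real.log lam / 2 - 6 * lam) ≤ lam * U := by gcongr
  have hll : lam ≤ lam ^ 2 := by nlinarith
  have hmain : lam * (lam - d) ^ 2 - 2 * (lam - d) ^ 3 / 3 + (lam - d) ^ 2 / 2 + (lam - d) / 6
      = lam ^ 3 / 3 - lam * d ^ 2 + 2 * d ^ 3 / 3 + (lam - d) ^ 2 / 2 + (lam - d) / 6 := by ring
  have hsq : (lam - d) ^ 2 ≤ lam ^ 2 := by gcongr; linarith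
  have hsq0 : 0 ≤ (lam - d) ^ 2 := sq_nonneg _
  have hdl : 0 ≤ d * lam := by positivity
  rw [hmain, abs_le]
  constructor <;> linarith

end Moments

theorem sq_log_le {x : ℝ} (hx : 1 ≤ x) : Real.log x ^ 2 ≤ 4 * x := by
  have h0 : 0 < x := by linarith
  have h := Real.log_le_sub_one_of_pos (Real.sqrt_pos.2 h0)
  rw [Real.log_sqrt h0.le] at h
  have hl := Real.log_nonneg hx
  have hq : √x * √x = x := Real.mul_self_sqrt h0.le
  nlinarith [Real.sqrt_nonneg x]

/-- There are constants `C > 0`, `λ₀ > 0` such that for all `λ ≥ λ₀`,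
`|Var[L] − λ²/12 − λ·(log λ)/2| ≤ C·λ`, where `Var[L] = Ex[L²] − (Ex[L])²` and
`Ex[L^m] = ∑_{l=0}^∞ ((l+1)^m − l^m)/D_λ(l)`. -/
theorem variance_asymptotics :
    ∃ C > (0 : ℝ), ∃ lam₀ > (0 : ℝ), ∀ lam : ℝ, lam₀ ≤ lam →
      |(∑' l : ℕ, (((l : ℝ) + 1) ^ 2 - (l : ℝ) ^ 2) / D lam l)
          - (∑' l : ℕ, (((l : ℝ) + 1) ^ 1 - (l : ℝ) ^ 1) / D lam l) ^ 2
          - lam ^ 2 / 12 - lam * Real.log lam / 2|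
        ≤ C * lam := by
  refine ⟨10000, by norm_num, 1, one_pos, fun lam hlam => ?_⟩
  have h0 : 0 < lam := by linarith
  have h1 := abs_mul_first_moment_sub_le hlam
  have h2 := abs_mul_second_moment_sub_le hlam
  have e1 : ∑' l, overflow lam l
      = lam * ∑' l : ℕ, (((l : ℝ) + 1) ^ 1 - (l : ℝ) ^ 1) / D lam l := by
    rw [← tsum_mul_left]
    exact tsum_congr fun l => by unfold overflow; ring
  have e2 : ∑' l : ℕ, (2 * (l : ℝ) + 1) * overflow lam l
      = lam * ∑' l : ℕ, (((l : ℝ) + 1) ^ 2 - (l : ℝ) ^ 2) / D lam l := by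
    rw [← tsum_mul_left]
    exact tsum_congr fun l => by unfold overflow; ring
  rw [e1] at h1
  rw [e2] at h2
  generalize (∑' l : ℕ, (((l : ℝ) + 1) ^ 1 - (l : ℝ) ^ 1) / D lam l) = M₁ at h1 ⊢
  generalize (∑' l : ℕ, (((l : ℝ) + 1) ^ 2 - (l : ℝ) ^ 2) / D lam l) = M₂ at h2 ⊢
  have hlog := sq_log_le hlam
  have hlog0 := Real.log_nonneg hlam
  have hlog1 : Real.log lam ≤ lam := (Real.log_le_sub_one_of_pos h0).trans (by linarith)
  obtain ⟨r, hr⟩ : ∃ r, r = M₁ - lam / 2 - Real.log lam / 2 := ⟨_, rfl⟩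
  obtain ⟨q, hq⟩ : ∃ q, q = M₂ - lam ^ 2 / 3 - lam * Real.log lam := ⟨_, rfl⟩
  have hr1 : |r| ≤ 50 := by
    rw [show lam * M₁ - lam ^ 2 / 2 - lam * Real.log lam / 2 = r * lam by rw [hr]; ring,
      abs_mul, abs_of_pos h0] at h1
    exact le_of_mul_le_mul_right h1 h0
  have hq1 : |q| ≤ 200 * lam := by
    rw [show lam * M₂ - lam ^ 3 / 3 - lam ^ 2 * Real.log lam = q * lam by rw [hq]; ring,
      abs_mul, abs_of_pos h0] at h2
    exact le_of_mul_le_mul_right (by linarith) h0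
  have hkey : M₂ - M₁ ^ 2 - lam ^ 2 / 12 - lam * Real.log lam / 2
      = q - Real.log lam ^ 2 / 4 - r ^ 2 - r * (lam + Real.log lam) := by
    rw [hr, hq]; ring
  have hr2 : r ^ 2 ≤ 50 ^ 2 := sq_le_sq.2 (by rwa [abs_of_pos (by norm_num : (0 : ℝ) < 50)])
  have hr3 : |r * (lam + Real.log lam)| ≤ 50 * (2 * lam) := by
    rw [abs_mul, abs_of_nonneg (by linarith : 0 ≤ lam + Real.log lam)]
    gcongr
    linarith
  rw [hkey, abs_le]
  rw [abs_le] at hq1 hr3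
  constructor <;> linarith [sq_nonneg r, sq_nonneg (Real.log lam)]
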